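/- If X is a nested almost convex set with n = |X| ≥ 1 points, then there exists an integer k ≥ 1 such that n = 2^(k+1) − 2 or n = 3·2^(k−1) − 2; in particular, nested almost convex sets do not exist for any other cardinalities. -/

import Mathlib

open Set

noncomputable section

/-- Points of the plane. -/
abbrev Pt : Type := ℝ × ℝ

/-- The orientation determinant of the triple `(a, b, c)`:
`c` lies strictly to the left of the directed line from `a` to `b` iff `orient a b c > 0`. -/
def orient (a b c : Pt) : ℝ :=
  (b.1 - a.1) * (c.2 - a.2) - (b.2 - a.2) * (c.1 - a.1)

/-- A set of points is in general position if no three pairwise distinct points are collinear. -/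
def GenPos (X : Set Pt) : Prop :=
  ∀ a ∈ X, ∀ b ∈ X, ∀ c ∈ X, a ≠ b → a ≠ c → b ≠ c → orient a b c ≠ 0

/-- The set of extreme points of the convex hull of `S`. -/
def extremePts (S : Set Pt) : Set Pt := Set.extremePoints ℝ (convexHull ℝ S)

/-- Remove the extreme points of the convex hull (one peeling step of convex layers). -/
def peel (S : Set Pt) : Set Pt := S \ extremePts S

/-- `X` has exactly `k` convex layers. -/
def HasLayers (X : Set Pt) (k : ℕ) : Prop :=
  peel^[k] X = ∅ ∧ ∀ j < k, peel^[j] X ≠ ∅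

/-- `X_j`, the union of the `j` innermost convex layers (when `X` has `k` layers). -/
def layerSub (X : Set Pt) (k j : ℕ) : Set Pt := peel^[k - j] X

/-- `R_j`, the `j`-th convex layer of `X` (when `X` has `k` layers), `R_1` innermost. -/
def layer (X : Set Pt) (k j : ℕ) : Set Pt := extremePts (layerSub X k j)

/-- `X` is a nested almost convex set. -/
def IsNACS (X : Set Pt) : Prop :=
  X.Finite ∧ X.Nonempty ∧ GenPos X ∧
  ∀ k, HasLayers X k →
    ∀ j, 1 ≤ j → j ≤ k →
      ∀ a ∈ layer X k j, ∀ b ∈ layer X k j, ∀ c ∈ layer X k j,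
        a ≠ b → a ≠ c → b ≠ c →
        ∃! p : Pt, p ∈ layerSub X k (j - 1) ∩ interior (convexHull ℝ ({a, b, c} : Set Pt))

/-- `q` is a counterclockwise enumeration of `S`. -/
def CCWEnum {m : ℕ} (S : Set Pt) (q : Fin m → Pt) : Prop :=
  Function.Injective q ∧ Set.range q = S ∧
  ∀ a b c : Fin m, a < b → b < c → 0 < orient (q a) (q b) (q c)

/-- The ordered pair `(q1, q2)` of points of `R` is adoptable from `p`. -/
def AdoptablePair (R : Set Pt) (p q1 q2 : Pt) : Prop :=
  ∀ q3 ∈ R \ ({q1, q2} : Set Pt), p ∈ interior (convexHull ℝ ({q1, q2, q3} : Set Pt))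

/-- The `i`-th binary string of length `j` in lexicographic order (`false` before `true`). -/
def strOfNat (j i : ℕ) : List Bool :=
  (List.range j).map fun t => i.testBit (j - 1 - t)

/-- The numeric (lexicographic) rank of a binary string among strings of its length. -/
def natOfStr (s : List Bool) : ℕ := s.foldl (fun n b => 2 * n + b.toNat) 0

/-- The leftmost `k`-level descendant of the node `s`. -/
def firstStr (k : ℕ) (s : List Bool) : List Bool := s ++ List.replicate (k - s.length) false

/-- The rightmost `k`-level descendant of the node `s`. -/
def lastStr (k : ℕ) (s : List Bool) : List Bool := s ++ List.replicate (k - s.length) true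

/-- Non-root nodes of the tree `T₁(k)`: binary strings of length `1..k`. -/
def ValidNode1 (k : ℕ) (s : List Bool) : Prop := 1 ≤ s.length ∧ s.length ≤ k

/-- A type-1 labeling of `X`, given by its label function `x` (the inverse of `ψ`). -/
def IsLabeling1 (k : ℕ) (X : Set Pt) (x : List Bool → Pt) : Prop :=
  Set.InjOn x {s | ValidNode1 k s} ∧ x '' {s | ValidNode1 k s} = X

/-- A type-1 labeling is nested. -/
def Nested1 (k : ℕ) (X : Set Pt) (x : List Bool → Pt) : Prop :=
  ∀ j, 1 ≤ j → j ≤ k →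
    CCWEnum (layer X k j) fun i : Fin (2 ^ j) => x (strOfNat j i.val)

/-- A type-1 labeling is adoptable. -/
def Adoptable1 (k : ℕ) (X : Set Pt) (x : List Bool → Pt) : Prop :=
  ∀ s : List Bool, 1 ≤ s.length → s.length + 1 ≤ k →
    AdoptablePair (layer X k (s.length + 1)) (x s) (x (s ++ [false])) (x (s ++ [true]))

/-- `previous[R_k(u)]` for a type-1 labeling: the cyclic predecessor (in the left-to-right,
i.e. counterclockwise, order of the `k`-level) of `first[R_k(u)]`. -/
def prev1 (k : ℕ) (x : List Bool → Pt) (s : List Bool) : Pt :=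
  x (strOfNat k ((natOfStr (firstStr k s) + (2 ^ k - 1)) % 2 ^ k))

/-- `next[R_k(u)]` for a type-1 labeling: the cyclic successor of `last[R_k(u)]`. -/
def next1 (k : ℕ) (x : List Bool → Pt) (s : List Bool) : Pt :=
  x (strOfNat k ((natOfStr (lastStr k s) + 1) % 2 ^ k))

/-- A type-1 labeling is well laid. -/
def WellLaid1 (k : ℕ) (x : List Bool → Pt) : Prop :=
  ∀ s : List Bool, 1 ≤ s.length → s.length ≤ k →
    x s ∈ convexHull ℝ ({prev1 k x s, x (firstStr k s), x (lastStr k s)} : Set Pt) ∧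
    x s ∈ convexHull ℝ ({x (firstStr k s), x (lastStr k s), next1 k x s} : Set Pt)

/-- `X_u` for a type-1 labeling: the labels of the proper descendants of `s`. -/
def descSet1 (k : ℕ) (x : List Bool → Pt) (s : List Bool) : Set Pt :=
  x '' {t | ValidNode1 k t ∧ s <+: t ∧ s ≠ t}

/-- `X̄_u = X_u ∪ {x_u}` for a type-1 labeling. -/
def barSet1 (k : ℕ) (x : List Bool → Pt) (s : List Bool) : Set Pt :=
  insert (x s) (descSet1 k x s)

/-- A type-1 labeling is an internal separation. -/
def InternalSep1 (k : ℕ) (X : Set Pt) (x : List Bool → Pt) : Prop :=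
  ∀ s : List Bool, s.length + 1 ≤ k →
    ∀ y ∈ X \ descSet1 k x s,
      ∀ a ∈ barSet1 k x (s ++ [false]), ∀ b ∈ barSet1 k x (s ++ [true]),
        0 < orient a b y

/-- A type-1 labeling is an external separation. -/
def ExternalSep1 (k : ℕ) (X : Set Pt) (x : List Bool → Pt) : Prop :=
  ∀ s : List Bool, 1 ≤ s.length → s.length + 1 ≤ k →
    ∀ y ∈ X \ barSet1 k x s,
      (∀ a ∈ barSet1 k x (s ++ [false]), 0 < orient a (x s) y) ∧
      (∀ b ∈ barSet1 k x (s ++ [true]), 0 < orient (x s) b y)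

/-- Nodes of the tree `T₂(k)`: the root `none`, and pairs `(c, s)`. -/
abbrev Node2 : Type := Option (Fin 3 × List Bool)

/-- Valid nodes of `T₂(k)`: the root, and pairs `(c, s)` with `|s| ≤ k - 2`. -/
def ValidNode2 (k : ℕ) : Node2 → Prop
  | none => True
  | some (_, s) => s.length + 2 ≤ k

/-- A type-2 labeling of `X`, given by its label function `x` (the inverse of `ψ`). -/
def IsLabeling2 (k : ℕ) (X : Set Pt) (x : Node2 → Pt) : Prop :=
  Set.InjOn x {u | ValidNode2 k u} ∧ x '' {u | ValidNode2 k u} = X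

/-- The `i`-th node (left-to-right) of the `(j+2)`-level of `T₂(k)`. -/
def node2At (j i : ℕ) : Node2 :=
  some (⟨i / 2 ^ j % 3, by omega⟩, strOfNat j (i % 2 ^ j))

/-- A type-2 labeling is nested. -/
def Nested2 (k : ℕ) (X : Set Pt) (x : Node2 → Pt) : Prop :=
  CCWEnum (layer X k 1) (fun _ : Fin 1 => x none) ∧
  ∀ j : ℕ, j + 2 ≤ k →
    CCWEnum (layer X k (j + 2)) fun i : Fin (3 * 2 ^ j) => x (node2At j i.val)

/-- A type-2 labeling is adoptable. -/
def Adoptable2 (k : ℕ) (X : Set Pt) (x : Node2 → Pt) : Prop :=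
  ∀ (c : Fin 3) (s : List Bool), s.length + 3 ≤ k →
    AdoptablePair (layer X k (s.length + 3)) (x (some (c, s)))
      (x (some (c, s ++ [false]))) (x (some (c, s ++ [true])))

/-- `previous[R_k(u)]` for a type-2 labeling, `u = (c, s)`. -/
def prev2 (k : ℕ) (x : Node2 → Pt) (c : Fin 3) (s : List Bool) : Pt :=
  x (node2At (k - 2)
      ((c.val * 2 ^ (k - 2) + natOfStr (firstStr (k - 2) s) + (3 * 2 ^ (k - 2) - 1)) %
        (3 * 2 ^ (k - 2))))

/-- `next[R_k(u)]` for a type-2 labeling, `u = (c, s)`. -/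
def next2 (k : ℕ) (x : Node2 → Pt) (c : Fin 3) (s : List Bool) : Pt :=
  x (node2At (k - 2)
      ((c.val * 2 ^ (k - 2) + natOfStr (lastStr (k - 2) s) + 1) % (3 * 2 ^ (k - 2))))

/-- A type-2 labeling is well laid (the root is the only node with `R_k(u) = R_k`). -/
def WellLaid2 (k : ℕ) (x : Node2 → Pt) : Prop :=
  ∀ (c : Fin 3) (s : List Bool), s.length + 2 ≤ k →
    x (some (c, s)) ∈ convexHull ℝ
      ({prev2 k x c s, x (some (c, firstStr (k - 2) s)),
        x (some (c, lastStr (k - 2) s))} : Set Pt) ∧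
    x (some (c, s)) ∈ convexHull ℝ
      ({x (some (c, firstStr (k - 2) s)), x (some (c, lastStr (k - 2) s)),
        next2 k x c s} : Set Pt)

/-- `X_u` for a type-2 labeling and a non-root node `u = (c, s)`. -/
def descSet2 (k : ℕ) (x : Node2 → Pt) (c : Fin 3) (s : List Bool) : Set Pt :=
  x '' {u | ∃ t : List Bool, u = some (c, t) ∧ t.length + 2 ≤ k ∧ s <+: t ∧ s ≠ t}

/-- `X̄_u = X_u ∪ {x_u}` for a type-2 labeling and a non-root node `u = (c, s)`. -/
def barSet2 (k : ℕ) (x : Node2 → Pt) (c : Fin 3) (s : List Bool) : Set Pt :=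
  insert (x (some (c, s))) (descSet2 k x c s)

/-- A type-2 labeling is an internal separation. -/
def InternalSep2 (k : ℕ) (X : Set Pt) (x : Node2 → Pt) : Prop :=
  (∀ (c : Fin 3) (s : List Bool), s.length + 3 ≤ k →
    ∀ y ∈ X \ descSet2 k x c s,
      ∀ a ∈ barSet2 k x c (s ++ [false]), ∀ b ∈ barSet2 k x c (s ++ [true]),
        0 < orient a b y) ∧
  (∀ i : Fin 3,
    ∀ y ∈ X \ (barSet2 k x i [] ∪ barSet2 k x (i + 1) []),
      ∀ a ∈ barSet2 k x i [], ∀ b ∈ barSet2 k x (i + 1) [],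
        0 < orient a b y)

/-- A type-2 labeling is an external separation. -/
def ExternalSep2 (k : ℕ) (X : Set Pt) (x : Node2 → Pt) : Prop :=
  ∀ (c : Fin 3) (s : List Bool), s.length + 3 ≤ k →
    ∀ y ∈ X \ barSet2 k x c s,
      (∀ a ∈ barSet2 k x c (s ++ [false]), 0 < orient a (x (some (c, s))) y) ∧
      (∀ b ∈ barSet2 k x c (s ++ [true]), 0 < orient (x (some (c, s))) b y)

/-- One corner-refinement step: from `α_s = (q, o, p)` to `α_{s0}` (for `b = false`)
or `α_{s1}` (for `b = true`). -/
def cornerStep (α : Pt × Pt × Pt) (b : Bool) : Pt × Pt × Pt :=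
  let q := α.1
  let o := α.2.1
  let p := α.2.2
  if b then (o + (1 / 5 : ℝ) • (q - o), o + (1 / 5 : ℝ) • (p - o), o + (2 / 5 : ℝ) • (p - o))
  else (o + (2 / 5 : ℝ) • (q - o), o + (1 / 5 : ℝ) • (q - o), o + (1 / 5 : ℝ) • (p - o))

/-- The corner `α_s = (q_s, o_s, p_s)` assigned to the binary string `s` (with parameter `k`). -/
def corner (k : ℕ) (s : List Bool) : Pt × Pt × Pt :=
  s.foldl cornerStep
    (((0 : ℝ), (2 * 5 ^ (k + 1) : ℝ)), ((0 : ℝ), (0 : ℝ)), ((2 * 5 ^ (k + 1) : ℝ), (0 : ℝ)))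

/-- The point `y_v` for a binary string `v = s ++ [b]` of positive length. -/
def ypt (k : ℕ) (v : List Bool) : Pt :=
  let α := corner k v.dropLast
  if v.getLastD false then α.2.1 + (1 / 5 : ℝ) • (α.2.2 - α.2.1)
  else α.2.1 + (1 / 5 : ℝ) • (α.1 - α.2.1)

/-- The point `x_s`: the midpoint of `y_{s·0^(k+1−|s|)}` and `y_{s·1^(k+1−|s|)}`. -/
def xpt (k : ℕ) (s : List Bool) : Pt :=
  (1 / 2 : ℝ) •
    (ypt k (s ++ List.replicate (k + 1 - s.length) false) +
      ypt k (s ++ List.replicate (k + 1 - s.length) true))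

lemma interleave_card (P Y : Finset ℝ) (hP : P.Nonempty)
    (hlo : ∀ y ∈ Y, ∃ p ∈ P, p < y) (hhi : ∀ y ∈ Y, ∃ p ∈ P, y < p)
    (hd : ∀ y ∈ Y, y ∉ P)
    (hgap : ∀ p ∈ P, ∀ q ∈ P, p < q → (∀ r ∈ P, r ≤ p ∨ q ≤ r) →
      ∃! y, y ∈ Y ∧ p < y ∧ y < q) :
    P.card = Y.card + 1 := by
  classical
  have hnext : ∀ p ∈ P, (∃ r ∈ P, p < r) → ∃ q ∈ P, p < q ∧ ∀ r ∈ P, r ≤ p ∨ q ≤ r := by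
    rintro p hp ⟨r, hr, hpr⟩
    have hne : (P.filter (fun x => p < x)).Nonempty := ⟨r, by simp [hr, hpr]⟩
    have hm := Finset.min'_mem _ hne
    refine ⟨_, (Finset.mem_filter.1 hm).1, (Finset.mem_filter.1 hm).2, fun s hs => ?_⟩
    by_cases h : s ≤ p
    · exact Or.inl h
    · exact Or.inr (Finset.min'_le _ _ (by simp [hs]; exact lt_of_not_ge h))
  have hprev : ∀ y ∈ Y, ∃ p ∈ P, p < y ∧ ∀ r ∈ P, r < y → r ≤ p := by
    intro y hy
    obtain ⟨r, hr, hry⟩ := hlo y hy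
    have hne : (P.filter (fun x => x < y)).Nonempty := ⟨r, by simp [hr, hry]⟩
    have hm := Finset.max'_mem _ hne
    refine ⟨_, (Finset.mem_filter.1 hm).1, (Finset.mem_filter.1 hm).2, fun s hs h => ?_⟩
    exact Finset.le_max' _ _ (by simp [hs, h])
  choose! g hgP hgy hgm using hprev
  have hM := Finset.max'_mem P hP
  have key : Y.card = (P.erase (P.max' hP)).card := by
    refine Finset.card_bij (fun y _ => g y) ?_ ?_ ?_
    · intro y hy
      refine Finset.mem_erase.2 ⟨?_, hgP y hy⟩
      obtain ⟨q, hq, hyq⟩ := hhi y hy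
      have := P.le_max' q hq
      have := hgy y hy
      intro h
      linarith
    · intro y hy y' hy' h
      obtain ⟨q0, hq0, hyq0⟩ := hhi y hy
      obtain ⟨q, hq, hpq, hcons⟩ := hnext (g y) (hgP y hy) ⟨q0, hq0, (hgy y hy).trans hyq0⟩
      have aux : ∀ z ∈ Y, g z = g y → z < q := by
        intro z hz hzg
        by_contra hc
        rcases lt_or_eq_of_le (not_lt.1 hc) with h1 | h1
        · have := hgm z hz q hq h1
          linarith
        · exact hd z hz (h1 ▸ hq)
      have h' : g y = g y' := h
      refine (hgap (g y) (hgP y hy) q hq hpq hcons).unique ⟨hy, hgy y hy, aux y hy rfl⟩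
        ⟨hy', ?_, aux y' hy' h'.symm⟩
      rw [h']; exact hgy y' hy'
    · intro p hp
      obtain ⟨hpne, hp⟩ := Finset.mem_erase.1 hp
      obtain ⟨q, hq, hpq, hcons⟩ := hnext p hp
        ⟨_, hM, lt_of_le_of_ne (P.le_max' p hp) hpne⟩
      obtain ⟨y, ⟨hy, h1, h2⟩, -⟩ := hgap p hp q hq hpq hcons
      refine ⟨y, hy, le_antisymm ?_ (hgm y hy p hp h1)⟩
      rcases hcons _ (hgP y hy) with h | h
      · exact h
      · have := hgy y hy
        linarith
  rw [key, Finset.card_erase_add_one hM]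

lemma orient_nonneg_hull (a b : Pt) (R : Set Pt) (h : ∀ r ∈ R, 0 ≤ orient a b r)
    (y : Pt) (hy : y ∈ convexHull ℝ R) : 0 ≤ orient a b y := by
  have hc : Convex ℝ {x : Pt | 0 ≤ orient a b x} := by
    intro x hx z hz s t hs ht hst
    simp only [Set.mem_ofPred_eq, orient, Prod.fst_add, Prod.snd_add, Prod.smul_fst,
      Prod.smul_snd, smul_eq_mul] at *
    have e : t = 1 - s := by linarith
    subst e
    nlinarith [mul_nonneg hs hx, mul_nonneg ht hz]
  exact convexHull_min (fun r hr => h r hr) hc hy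

lemma mem_tri (a b c y : Pt) (h1 : 0 ≤ orient a b y) (h2 : 0 ≤ orient b c y)
    (h3 : 0 ≤ orient c a y) (h : 0 < orient a b c) :
    y ∈ convexHull ℝ ({a, b, c} : Set Pt) := by
  have hs : orient a b y + orient b c y + orient c a y = orient a b c := by
    simp only [orient]; ring
  have hne := h.ne'
  have e : y = (orient b c y / orient a b c) • a + (orient c a y / orient a b c) • b
      + (orient a b y / orient a b c) • c := by
    ext
    · simp only [Prod.fst_add, Prod.smul_fst, smul_eq_mul]
      field_simp
      simp only [orient]; ring
    · simp only [Prod.snd_add, Prod.smul_snd, smul_eq_mul]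
      field_simp
      simp only [orient]; ring
  have hc := convex_convexHull ℝ ({a, b, c} : Set Pt)
  rw [e]
  have hsum : orient b c y / orient a b c + orient c a y / orient a b c
      + orient a b y / orient a b c = 1 := by
    field_simp; linarith
  have := hc.sum_mem (t := Finset.univ) (w := ![orient b c y / orient a b c,
    orient c a y / orient a b c, orient a b y / orient a b c]) (z := ![a, b, c]) ?_ ?_ ?_
  · simpa [Fin.sum_univ_three] using this
  · intro i _
    fin_cases i <;> simp <;> positivity
  · simpa [Fin.sum_univ_three] using hsum
  · intro i _
    apply subset_convexHull
    fin_cases i <;> simp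

lemma mem_int_tri (a b c y : Pt) (h1 : 0 < orient a b y) (h2 : 0 < orient b c y)
    (h3 : 0 < orient c a y) (h : 0 < orient a b c) :
    y ∈ interior (convexHull ℝ ({a, b, c} : Set Pt)) := by
  have hcont : ∀ a b : Pt, Continuous (fun x => orient a b x) := by
    intro a b; unfold orient; fun_prop
  have ho : IsOpen {x : Pt | 0 < orient a b x ∧ 0 < orient b c x ∧ 0 < orient c a x} :=
    (isOpen_lt continuous_const (hcont a b)).inter
      ((isOpen_lt continuous_const (hcont b c)).inter
        (isOpen_lt continuous_const (hcont c a)))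
  refine interior_maximal ?_ ho ⟨h1, h2, h3⟩
  rintro x ⟨x1, x2, x3⟩
  exact mem_tri a b c x x1.le x2.le x3.le h

lemma orient_rot (a b c : Pt) : orient a b c = orient b c a := by
  simp only [orient]; ring

lemma orient_swap (a b c : Pt) : orient a b c = - orient b a c := by
  simp only [orient]; ring

lemma orient_self1 (a b : Pt) : orient a b a = 0 := by simp only [orient]; ring
lemma orient_self2 (a b : Pt) : orient a b b = 0 := by simp only [orient]; ring

/-- An extreme point of the hull of `S` is not in the hull of other points of `S`. -/
lemma extreme_not_mem (S : Set Pt) (v : Pt) (hv : v ∈ extremePts S) (T : Set Pt)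
    (hT : T ⊆ S) (hvT : v ∉ T) : v ∉ convexHull ℝ T := by
  have h := ((convex_convexHull ℝ S).mem_extremePoints_iff_mem_sdiff_convexHull_sdiff).1 hv
  intro hc
  apply h.2
  refine convexHull_mono ?_ hc
  intro t ht
  exact ⟨subset_convexHull ℝ S (hT ht), fun e => hvT (e ▸ ht)⟩

lemma hull_eq (S : Set Pt) (hS : S.Finite) : convexHull ℝ (extremePts S) = convexHull ℝ S := by
  have hk := closure_convexHull_extremePoints (hS.isCompact_convexHull ℝ) (convex_convexHull ℝ S)
  have hf : (extremePts S).Finite := hS.subset extremePoints_convexHull_subset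
  exact (hf.isClosed_convexHull ℝ).closure_eq.symm.trans hk

lemma extreme_nonempty (S : Set Pt) (hS : S.Finite) (hne : S.Nonempty) :
    (extremePts S).Nonempty :=
  (hS.isCompact_convexHull ℝ).extremePoints_nonempty hne.convexHull

lemma exists_key (S : Set Pt) (hS : S.Finite) (v : Pt) (hv : v ∈ extremePts S) :
    ∃ κ : Pt → ℝ, ∀ a ∈ S, ∀ b ∈ S, a ≠ v → b ≠ v → (0 < orient v a b ↔ κ a < κ b) := by
  have hn := extreme_not_mem S v hv (S \ {v}) sdiff_subset (by simp)
  have hcl : IsClosed (convexHull ℝ (S \ {v})) := (hS.subset sdiff_subset).isClosed_convexHull ℝ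
  obtain ⟨f, u, hu1, hu2⟩ := geometric_hahn_banach_point_closed (convex_convexHull ℝ _) hcl hn
  have hf : ∀ x : Pt, f x = x.1 * f (1, 0) + x.2 * f (0, 1) := by
    intro x
    have : x = x.1 • ((1 : ℝ), (0 : ℝ)) + x.2 • ((0 : ℝ), (1 : ℝ)) := by
      ext <;> simp
    conv_lhs => rw [this]
    simp only [map_add, map_smul, smul_eq_mul]
  set α := f (1, 0)
  set β := f (0, 1)
  have hpos : ∀ a ∈ S, a ≠ v → 0 < α * (a.1 - v.1) + β * (a.2 - v.2) := by
    intro a ha hav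
    have := hu2 a (subset_convexHull ℝ _ ⟨ha, hav⟩)
    rw [hf] at this hu1
    linarith
  refine ⟨fun x => (α * (x.2 - v.2) - β * (x.1 - v.1)) /
    (α * (x.1 - v.1) + β * (x.2 - v.2)), ?_⟩
  intro a ha b hb hav hbv
  have h1 := hpos a ha hav
  have h2 := hpos b hb hbv
  have hαβ : 0 < α ^ 2 + β ^ 2 := by
    by_contra hc
    have h3 : α = 0 := by nlinarith [sq_nonneg α, sq_nonneg β]
    have h4 : β = 0 := by nlinarith [sq_nonneg α, sq_nonneg β]
    rw [h3, h4] at h1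
    simp at h1
  rw [div_lt_div_iff₀ h1 h2,
    ← sub_pos (a := (α * (b.2 - v.2) - β * (b.1 - v.1)) * (α * (a.1 - v.1) + β * (a.2 - v.2)))]
  have e : (α * (b.2 - v.2) - β * (b.1 - v.1)) * (α * (a.1 - v.1) + β * (a.2 - v.2)) -
      (α * (a.2 - v.2) - β * (a.1 - v.1)) * (α * (b.1 - v.1) + β * (b.2 - v.2))
      = (α ^ 2 + β ^ 2) * orient v a b := by
    simp only [orient]; ring
  rw [e]
  exact (mul_pos_iff_of_pos_left hαβ).symm

lemma ring_card (S : Set Pt) (hS : S.Finite) (hg : GenPos S) (hne : (peel S).Nonempty)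
    (h : ∀ a ∈ extremePts S, ∀ b ∈ extremePts S, ∀ c ∈ extremePts S,
        a ≠ b → a ≠ c → b ≠ c →
        ∃! p : Pt, p ∈ peel S ∩ interior (convexHull ℝ ({a, b, c} : Set Pt))) :
    (extremePts S).ncard = (peel S).ncard + 2 := by
  classical
  have hRS : extremePts S ⊆ S := extremePoints_convexHull_subset
  have hRf : (extremePts S).Finite := hS.subset hRS
  have hYf : (peel S).Finite := hS.subset sdiff_subset
  have hYS : peel S ⊆ S := sdiff_subset
  obtain ⟨y0, hy0⟩ := hne
  obtain ⟨v, hv⟩ := extreme_nonempty S hS ⟨y0, hYS hy0⟩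
  obtain ⟨κ, hκ⟩ := exists_key S hS v hv
  have hYR : ∀ y ∈ peel S, ∀ r ∈ extremePts S, y ≠ r := by
    rintro y hy r hr rfl
    exact hy.2 hr
  have hinj : ∀ a ∈ S, ∀ b ∈ S, a ≠ v → b ≠ v → κ a = κ b → a = b := by
    intro a ha b hb hav hbv he
    by_contra hab
    have h1 := hg v (hRS hv) a ha b hb hav.symm hbv.symm hab
    rcases lt_or_gt_of_ne h1 with h2 | h2
    · have h3 : 0 < orient v b a := by
        have : orient v b a = - orient v a b := by simp only [orient]; ring
        linarith
      have := (hκ b hb a ha hbv hav).1 h3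
      linarith
    · have := (hκ a ha b hb hav hbv).1 h2
      linarith
  have hyhull : ∀ y ∈ peel S, y ∈ convexHull ℝ (extremePts S) := by
    intro y hy
    rw [hull_eq S hS]
    exact subset_convexHull ℝ S (hYS hy)
  -- the other extreme points
  set P : Finset Pt := hRf.toFinset.erase v with hPdef
  have hP : ∀ x, x ∈ P ↔ x ≠ v ∧ x ∈ extremePts S := by
    intro x; simp [hPdef]
  have hPne : P.Nonempty := by
    by_contra hc
    rw [Finset.not_nonempty_iff_eq_empty] at hc
    have h1 : extremePts S ⊆ {v} := by
      intro x hx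
      by_contra hxv
      have : x ∈ P := (hP x).2 ⟨hxv, hx⟩
      simp [hc] at this
    have h2 := convexHull_mono h1 (hyhull y0 hy0)
    rw [convexHull_singleton] at h2
    exact hYR y0 hy0 v hv h2
  have hlo : ∀ y ∈ peel S, ∃ p ∈ P, κ p < κ y := by
    intro y hy
    obtain ⟨p, hp, hmin⟩ := P.exists_min_image κ hPne
    obtain ⟨hpv, hpR⟩ := (hP p).1 hp
    refine ⟨p, hp, ?_⟩
    rw [← hκ p (hRS hpR) y (hYS hy) hpv (hYR y hy v hv)]
    refine lt_of_le_of_ne (orient_nonneg_hull v p _ ?_ y (hyhull y hy))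
      (hg v (hRS hv) p (hRS hpR) y (hYS hy) hpv.symm (hYR y hy v hv).symm
        (hYR y hy p hpR).symm).symm
    intro r hr
    by_cases hrv : r = v
    · rw [hrv, orient_self1]
    by_cases hrp : r = p
    · rw [hrp, orient_self2]
    have h1 := hmin r ((hP r).2 ⟨hrv, hr⟩)
    refine ((hκ p (hRS hpR) r (hRS hr) hpv hrv).2 (lt_of_le_of_ne h1 fun e => hrp ?_)).le
    exact (hinj p (hRS hpR) r (hRS hr) hpv hrv e).symm
  have hhi : ∀ y ∈ peel S, ∃ p ∈ P, κ y < κ p := by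
    intro y hy
    obtain ⟨p, hp, hmax⟩ := P.exists_max_image κ hPne
    obtain ⟨hpv, hpR⟩ := (hP p).1 hp
    refine ⟨p, hp, ?_⟩
    rw [← hκ y (hYS hy) p (hRS hpR) (hYR y hy v hv) hpv, ← orient_rot p v y]
    refine lt_of_le_of_ne (orient_nonneg_hull p v _ ?_ y (hyhull y hy))
      (hg p (hRS hpR) v (hRS hv) y (hYS hy) hpv (hYR y hy p hpR).symm
        (hYR y hy v hv).symm).symm
    intro r hr
    by_cases hrv : r = v
    · rw [hrv, orient_self2]
    by_cases hrp : r = p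
    · rw [hrp, orient_self1]
    have h1 := hmax r ((hP r).2 ⟨hrv, hr⟩)
    rw [orient_rot p v r]
    refine ((hκ r (hRS hr) p (hRS hpR) hrv hpv).2 (lt_of_le_of_ne h1 fun e => hrp ?_)).le
    exact hinj r (hRS hr) p (hRS hpR) hrv hpv e
  -- consecutive points
  have hgap : ∀ p ∈ P, ∀ q ∈ P, κ p < κ q → (∀ r ∈ P, κ r ≤ κ p ∨ κ q ≤ κ r) →
      ∃! y, y ∈ peel S ∧ κ p < κ y ∧ κ y < κ q := by
    intro p hp q hq hpq hcons
    obtain ⟨hpv, hpR⟩ := (hP p).1 hp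
    obtain ⟨hqv, hqR⟩ := (hP q).1 hq
    have hpq' : p ≠ q := by rintro rfl; exact lt_irrefl _ hpq
    have hvpq := (hκ p (hRS hpR) q (hRS hqR) hpv hqv).2 hpq
    have hside : ∀ r ∈ extremePts S, 0 ≤ orient p q r := by
      intro r hr
      by_cases hrv : r = v
      · rw [hrv, ← orient_rot v p q]; exact hvpq.le
      by_cases hrp : r = p
      · rw [hrp, orient_self1]
      by_cases hrq : r = q
      · rw [hrq, orient_self2]
      by_contra hc
      rw [not_le] at hc
      rcases hcons r ((hP r).2 ⟨hrv, hr⟩) with h1 | h1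
      · have h1' : κ r < κ p := lt_of_le_of_ne h1 fun e =>
          hrp (hinj r (hRS hr) p (hRS hpR) hrv hpv e)
        have o1 := (hκ r (hRS hr) p (hRS hpR) hrv hpv).2 h1'
        have o2 := (hκ r (hRS hr) q (hRS hqR) hrv hqv).2 (h1'.trans hpq)
        refine extreme_not_mem S p hpR {v, r, q} ?_ ?_ (mem_tri v r q p o1.le ?_ ?_ o2)
        · rintro x (rfl | rfl | rfl)
          exacts [hRS hv, hRS hr, hRS hqR]
        · simp only [mem_insert_iff, mem_singleton_iff, not_or]
          exact ⟨hpv, fun e => hrp e.symm, hpq'⟩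
        · have : orient r q p = - orient p q r := by simp only [orient]; ring
          linarith
        · have : orient q v p = orient v p q := by simp only [orient]; ring
          linarith
      · have h1' : κ q < κ r := lt_of_le_of_ne h1 fun e =>
          hrq (hinj q (hRS hqR) r (hRS hr) hqv hrv e).symm
        have o1 := (hκ q (hRS hqR) r (hRS hr) hqv hrv).2 h1'
        have o2 := (hκ p (hRS hpR) r (hRS hr) hpv hrv).2 (hpq.trans h1')
        refine extreme_not_mem S q hqR {v, p, r} ?_ ?_ (mem_tri v p r q hvpq.le ?_ ?_ o2)
        · rintro x (rfl | rfl | rfl)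
          exacts [hRS hv, hRS hpR, hRS hr]
        · simp only [mem_insert_iff, mem_singleton_iff, not_or]
          exact ⟨hqv, hpq'.symm, fun e => hrq e.symm⟩
        · have : orient p r q = - orient p q r := by simp only [orient]; ring
          linarith
        · have : orient r v q = orient v q r := by simp only [orient]; ring
          linarith
    have hiff : ∀ y, (y ∈ peel S ∩ interior (convexHull ℝ ({v, p, q} : Set Pt))) ↔
        (y ∈ peel S ∧ κ p < κ y ∧ κ y < κ q) := by
      intro y
      refine and_congr_right fun hy => ?_
      have hyv := hYR y hy v hv
      have hyp := hYR y hy p hpR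
      have hyq := hYR y hy q hqR
      rw [← hκ p (hRS hpR) y (hYS hy) hpv hyv, ← hκ y (hYS hy) q (hRS hqR) hyv hqv,
        ← orient_rot q v y]
      constructor
      · intro hi
        have hi' := interior_subset hi
        constructor
        · refine lt_of_le_of_ne (orient_nonneg_hull v p _ ?_ y hi')
            (hg v (hRS hv) p (hRS hpR) y (hYS hy) hpv.symm hyv.symm hyp.symm).symm
          rintro r (rfl | rfl | rfl)
          · rw [orient_self1]
          · rw [orient_self2]
          · exact hvpq.le
        · refine lt_of_le_of_ne (orient_nonneg_hull q v _ ?_ y hi')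
            (hg q (hRS hqR) v (hRS hv) y (hYS hy) hqv hyq.symm hyv.symm).symm
          rintro r (rfl | rfl | rfl)
          · rw [orient_self2]
          · rw [orient_rot]; exact hvpq.le
          · rw [orient_self1]
      · rintro ⟨h1, h2⟩
        refine mem_int_tri v p q y h1 ?_ h2 hvpq
        exact lt_of_le_of_ne (orient_nonneg_hull p q _ hside y (hyhull y hy))
          (hg p (hRS hpR) q (hRS hqR) y (hYS hy) hpq' hyp.symm hyq.symm).symm
    have := h v hv p hpR q hqR hpv.symm hqv.symm hpq'
    simpa only [hiff] using this
  have hPinj : Set.InjOn κ (P : Set Pt) := by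
    intro a ha b hb e
    obtain ⟨ha1, ha2⟩ := (hP a).1 ha
    obtain ⟨hb1, hb2⟩ := (hP b).1 hb
    exact hinj a (hRS ha2) b (hRS hb2) ha1 hb1 e
  have hYinj : Set.InjOn κ (hYf.toFinset : Set Pt) := by
    intro a ha b hb e
    have ha' : a ∈ peel S := by simpa using ha
    have hb' : b ∈ peel S := by simpa using hb
    exact hinj a (hYS ha') b (hYS hb') (hYR a ha' v hv) (hYR b hb' v hv) e
  have hcard := interleave_card (P.image κ) (hYf.toFinset.image κ) (hPne.image κ)
    (by
      intro t ht
      obtain ⟨y, hy, rfl⟩ := Finset.mem_image.1 ht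
      obtain ⟨p, hp, hpy⟩ := hlo y (by simpa using hy)
      exact ⟨κ p, Finset.mem_image_of_mem κ hp, hpy⟩) (by
      intro t ht
      obtain ⟨y, hy, rfl⟩ := Finset.mem_image.1 ht
      obtain ⟨p, hp, hpy⟩ := hhi y (by simpa using hy)
      exact ⟨κ p, Finset.mem_image_of_mem κ hp, hpy⟩) (by
      intro t ht ht'
      obtain ⟨y, hy, rfl⟩ := Finset.mem_image.1 ht
      obtain ⟨p, hp, hpe⟩ := Finset.mem_image.1 ht'
      have hy' : y ∈ peel S := by simpa using hy
      obtain ⟨h1, h2⟩ := (hP p).1 hp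
      exact hYR y hy' p h2 (hinj p (hRS h2) y (hYS hy') h1 (hYR y hy' v hv) hpe).symm) (by
      intro p' hp' q' hq' hpq hcons
      obtain ⟨p, hp, rfl⟩ := Finset.mem_image.1 hp'
      obtain ⟨q, hq, rfl⟩ := Finset.mem_image.1 hq'
      obtain ⟨y, ⟨hy, h1, h2⟩, hu⟩ := hgap p hp q hq hpq
        (fun r hr => hcons _ (Finset.mem_image_of_mem κ hr))
      refine ⟨κ y, ⟨Finset.mem_image_of_mem κ (by simpa using hy), h1, h2⟩, ?_⟩
      rintro z ⟨hz, h3, h4⟩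
      obtain ⟨w, hw, rfl⟩ := Finset.mem_image.1 hz
      rw [hu w ⟨by simpa using hw, h3, h4⟩])
  rw [Finset.card_image_of_injOn hPinj, Finset.card_image_of_injOn hYinj] at hcard
  have h1 : (extremePts S).ncard = P.card + 1 := by
    rw [Set.ncard_eq_toFinset_card _ hRf, hPdef, Finset.card_erase_add_one]
    simpa using hv
  rw [h1, hcard, Set.ncard_eq_toFinset_card _ hYf]

lemma exists_layers (X : Set Pt) (hX : X.Finite) : ∃ k, HasLayers X k := by
  have hfin : ∀ j, (peel^[j] X).Finite := by
    intro j
    induction j with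
    | zero => exact hX
    | succ j ih => rw [Function.iterate_succ_apply']; exact ih.subset sdiff_subset
  have hex : ∃ j, peel^[j] X = ∅ := by
    by_contra hc
    push Not at hc
    have hlt : ∀ j, (peel^[j + 1] X).ncard < (peel^[j] X).ncard := by
      intro j
      rw [Function.iterate_succ_apply']
      refine Set.ncard_lt_ncard ?_ (hfin j)
      obtain ⟨v, hv⟩ := extreme_nonempty _ (hfin j) (hc j)
      refine ⟨sdiff_subset, fun hs => (hs (extremePoints_convexHull_subset hv)).2 hv⟩
    have hb : ∀ j, (peel^[j] X).ncard + j ≤ X.ncard := by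
      intro j
      induction j with
      | zero => simp
      | succ j ih => have := hlt j; omega
    have h1 := hb (X.ncard + 1)
    omega
  classical
  exact ⟨Nat.find hex, Nat.find_spec hex, fun j hj => Nat.find_min hex hj⟩

/-- If `X` is a nested almost convex set with `n = |X| ≥ 1` points, then there
is an integer `k ≥ 1` with `n = 2^(k+1) − 2` or `n = 3·2^(k−1) − 2`. -/
theorem nacs_card (X : Set Pt) (hX : IsNACS X) (n : ℕ) (hn : n = X.ncard) (hn1 : 1 ≤ n) :
    ∃ k : ℕ, 1 ≤ k ∧ (n = 2 ^ (k + 1) - 2 ∨ n = 3 * 2 ^ (k - 1) - 2) := by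
  obtain ⟨hf, hne, hg, hl⟩ := hX
  obtain ⟨k, hk⟩ := exists_layers X hf
  have hl := hl k hk
  have hk1 : 1 ≤ k := by
    rcases Nat.eq_zero_or_pos k with h0 | h0
    · subst h0
      exact absurd hk.1 hne.ne_empty
    · exact h0
  have hsub : ∀ j, peel^[j] X ⊆ X := by
    intro j
    induction j with
    | zero => exact subset_rfl
    | succ j ih => rw [Function.iterate_succ_apply']; exact sdiff_subset.trans ih
  have hS : ∀ j, layerSub X k j ⊆ X := fun j => hsub _
  have hpeel : ∀ j, 1 ≤ j → j ≤ k → peel (layerSub X k j) = layerSub X k (j - 1) := by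
    intro j h1 h2
    unfold layerSub
    rw [← Function.iterate_succ_apply' peel]
    congr 2
    omega
  have hnonempty : ∀ j, 1 ≤ j → j ≤ k → (layerSub X k j).Nonempty := fun j h1 h2 =>
    Set.nonempty_iff_ne_empty.2 (hk.2 _ (by omega))
  have h0 : layerSub X k 0 = ∅ := hk.1
  have hgS : ∀ j, GenPos (layerSub X k j) := fun j a ha b hb c hc =>
    hg a (hS j ha) b (hS j hb) c (hS j hc)
  have hsplit : ∀ S : Set Pt, S.Finite → S.ncard = (extremePts S).ncard + (peel S).ncard := by
    intro S hSf
    have hsub' : extremePts S ⊆ S := extremePoints_convexHull_subset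
    have := Set.ncard_sdiff_add_ncard_of_subset hsub' hSf
    unfold peel
    omega
  have hstep : ∀ j, 1 ≤ j → j + 1 ≤ k →
      (layerSub X k (j + 1)).ncard = 2 * (layerSub X k j).ncard + 2 := by
    intro j h1 h2
    have hfS := hf.subset (hS (j + 1))
    have hp := hpeel (j + 1) (by omega) h2
    rw [Nat.add_sub_cancel] at hp
    have hc := ring_card _ hfS (hgS (j + 1)) (by rw [hp]; exact hnonempty j h1 (by omega)) (by
      rw [hp]
      exact hl (j + 1) (by omega) h2)
    rw [hsplit _ hfS, hc, hp]
    omega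
  have hone : (layerSub X k 1).ncard = 1 ∨ (layerSub X k 1).ncard = 2 := by
    have hfS := hf.subset (hS 1)
    have hpos := (Set.ncard_pos hfS).2 (hnonempty 1 le_rfl hk1)
    have hle : ¬ 2 < (layerSub X k 1).ncard := by
      intro hlt
      obtain ⟨a, b, c, ha, hb, hc, hab, hac, hbc⟩ := (Set.two_lt_ncard_iff hfS).1 hlt
      have hp := hpeel 1 le_rfl hk1
      rw [Nat.sub_self, h0] at hp
      have hR : ∀ x ∈ layerSub X k 1, x ∈ layer X k 1 := by
        intro x hx
        by_contra hc
        have : x ∈ peel (layerSub X k 1) := ⟨hx, hc⟩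
        rw [hp] at this
        exact this
      obtain ⟨p, hp, -⟩ := hl 1 le_rfl hk1 a (hR a ha) b (hR b hb) c (hR c hc) hab hac hbc
      have := hp.1
      rw [Nat.sub_self, h0] at this
      exact this
    omega
  have hnk : n = (layerSub X k k).ncard := by
    rw [hn]; simp [layerSub]
  refine ⟨k, hk1, ?_⟩
  rcases hone with h1 | h1
  · right
    have : ∀ j, 1 + j ≤ k → (layerSub X k (1 + j)).ncard + 2 = 3 * 2 ^ j := by
      intro j
      induction j with
      | zero => intro _; simp [h1]
      | succ j ih =>
        intro hj
        have h2 := ih (by omega)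
        have h3 := hstep (1 + j) (by omega) (by omega)
        rw [← add_assoc, h3, pow_succ]
        omega
    have h4 := this (k - 1) (by omega)
    rw [show 1 + (k - 1) = k by omega] at h4
    omega
  · left
    have : ∀ j, 1 + j ≤ k → (layerSub X k (1 + j)).ncard + 2 = 2 ^ (j + 2) := by
      intro j
      induction j with
      | zero => intro _; simp [h1]
      | succ j ih =>
        intro hj
        have h2 := ih (by omega)
        have h3 := hstep (1 + j) (by omega) (by omega)
        rw [← add_assoc, h3, show j + 1 + 2 = (j + 2) + 1 by omega, pow_succ]
        omega
    have h4 := this (k - 1) (by omega)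
    rw [show 1 + (k - 1) = k by omega, show k - 1 + 2 = k + 1 by omega] at h4
    omega
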